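/- arXiv:2005.00671 — 2 statements merged into one kernel-verified Lean document; each statement's English description precedes it below -/
import Mathlib

section
/- Let S be a k-spanner and let (H, H') ∈ Λ_μ(S). Then for each central vertex v of S, at most two of the legs attached to v have their inner edge in H ∪ H'; moreover, for every leg of S whose inner edge does not belong to H ∪ H', the outer edge of that leg belongs to H. -/
open Finset

section Defs
variable {V : Type*}

/-- A matching: a set of edges, pairwise non-adjacent. -/
def IsMatchingSet (G : SimpleGraph V) (M : Finset (Sym2 V)) : Prop :=
  ↑M ⊆ G.edgeSet ∧ ∀ e ∈ M, ∀ f ∈ M, e ≠ f → ∀ v : V, v ∈ e → v ∉ f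

/-- A vertex is saturated by a matching if some edge of it is incident to the vertex. -/
def Saturates (M : Finset (Sym2 V)) (v : V) : Prop :=
  ∃ e ∈ M, v ∈ e

/-- ν(G): maximum size of a matching. -/
noncomputable def nuG (G : SimpleGraph V) : ℕ :=
  sSup {n | ∃ M : Finset (Sym2 V), IsMatchingSet G M ∧ M.card = n}

/-- λ(G): maximum of |H| + |H'| over pairs of disjoint matchings. -/
noncomputable def lamG (G : SimpleGraph V) : ℕ :=
  sSup {n | ∃ H H' : Finset (Sym2 V), IsMatchingSet G H ∧ IsMatchingSet G H' ∧
    Disjoint H H' ∧ H.card + H'.card = n}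

/-- Λ(G): set of pairs of disjoint matchings realizing λ(G). -/
def LambdaSet (G : SimpleGraph V) : Set (Finset (Sym2 V) × Finset (Sym2 V)) :=
  {p | IsMatchingSet G p.1 ∧ IsMatchingSet G p.2 ∧ Disjoint p.1 p.2 ∧
    p.1.card + p.2.card = lamG G}

/-- μ(G): maximum of |H| over pairs (H, H') ∈ Λ(G). -/
noncomputable def muG (G : SimpleGraph V) : ℕ :=
  sSup {n | ∃ p ∈ LambdaSet G, p.1.card = n}

/-- Λ_μ(G): pairs in Λ(G) with |H| = μ(G). -/
def LambdaMuSet (G : SimpleGraph V) : Set (Finset (Sym2 V) × Finset (Sym2 V)) :=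
  {p | p ∈ LambdaSet G ∧ p.1.card = muG G}

end Defs

/-- Vertex type of a k-spanner: two central vertices and 4+k legs of two vertices each. -/
abbrev SpannerV (k : ℕ) : Type := Fin 2 ⊕ (Fin (4 + k) × Fin 2)

/-- The k-spanner determined by the attachment function `attach` assigning each of
the 4+k legs to one of the two central vertices.  Leg `i` consists of the middle
vertex `Sum.inr (i, 0)` and the leaf `Sum.inr (i, 1)`; its inner edge joins the
central vertex `Sum.inl (attach i)` to `Sum.inr (i, 0)` and its outer edge joins
`Sum.inr (i, 0)` to `Sum.inr (i, 1)`. The two central vertices are adjacent. -/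
def spannerGraph (k : ℕ) (attach : Fin (4 + k) → Fin 2) : SimpleGraph (SpannerV k) :=
  SimpleGraph.fromRel (fun u v =>
    (u = Sum.inl 0 ∧ v = Sum.inl 1) ∨
    (∃ i : Fin (4 + k), u = Sum.inl (attach i) ∧ v = Sum.inr (i, 0)) ∨
    (∃ i : Fin (4 + k), u = Sum.inr (i, 0) ∧ v = Sum.inr (i, 1)))

/-- `attach` describes a genuine k-spanner: at least two legs attached to each
central vertex (the base spanner already has two legs at each). -/
def IsKSpannerAttach (k : ℕ) (attach : Fin (4 + k) → Fin 2) : Prop :=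
  2 ≤ (Finset.univ.filter fun i => attach i = 0).card ∧
  2 ≤ (Finset.univ.filter fun i => attach i = 1).card

/-- The cardinalities of finite subsets of a finite type form bounded sets. -/
theorem exists_forall_card_le (V : Type*) [Finite V] :
    ∃ N, ∀ M : Finset (Sym2 V), M.card ≤ N := by
  classical
  have := Fintype.ofFinite V
  exact ⟨Fintype.card (Sym2 V), fun M => M.card_le_univ⟩

theorem card_add_card_le_lamG {V : Type*} [Finite V] {G : SimpleGraph V}
    {H H' : Finset (Sym2 V)} (hH : IsMatchingSet G H) (hH' : IsMatchingSet G H')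
    (hd : Disjoint H H') : H.card + H'.card ≤ lamG G := by
  obtain ⟨N, hN⟩ := exists_forall_card_le V
  refine le_csSup ⟨N + N, ?_⟩ ⟨H, H', hH, hH', hd, rfl⟩
  rintro n ⟨K, K', -, -, -, rfl⟩
  exact add_le_add (hN K) (hN K')

theorem card_le_muG {V : Type*} [Finite V] {G : SimpleGraph V}
    {p : Finset (Sym2 V) × Finset (Sym2 V)} (hp : p ∈ LambdaSet G) : p.1.card ≤ muG G := by
  obtain ⟨N, hN⟩ := exists_forall_card_le V
  refine le_csSup ⟨N, ?_⟩ ⟨p, hp, rfl⟩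
  rintro n ⟨q, -, rfl⟩
  exact hN q.1

theorem IsMatchingSet.mono {V : Type*} {G : SimpleGraph V} {M N : Finset (Sym2 V)}
    (hN : IsMatchingSet G N) (h : M ⊆ N) : IsMatchingSet G M :=
  ⟨fun _ he => hN.1 (h he), fun e he f hf => hN.2 e (h he) f (h hf)⟩

theorem IsMatchingSet.insert {V : Type*} [DecidableEq V] {G : SimpleGraph V}
    {M : Finset (Sym2 V)} (hM : IsMatchingSet G M) {e : Sym2 V} (he : e ∈ G.edgeSet)
    (hfree : ∀ f ∈ M, ∀ v ∈ e, v ∉ f) : IsMatchingSet G (insert e M) := by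
  refine ⟨?_, ?_⟩
  · intro f hf
    rcases Finset.mem_insert.1 hf with rfl | hf
    · exact he
    · exact hM.1 hf
  · intro f hf g hg hne v hvf hvg
    rw [Finset.mem_insert] at hf hg
    rcases hf with rfl | hf <;> rcases hg with rfl | hg
    · exact hne rfl
    · exact hfree g hg v hvf hvg
    · exact hfree f hf v hvg hvf
    · exact hM.2 f hf g hg hne v hvf hvg

/-- In a pair of `Λ_μ(G)`, the first matching is maximal: an edge adjacent to none of its other
edges belongs to it. -/
theorem mem_of_mem_LambdaMuSet {V : Type*} [Finite V] {G : SimpleGraph V}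
    {H H' : Finset (Sym2 V)} (h : (H, H') ∈ LambdaMuSet G) {e : Sym2 V} (he : e ∈ G.edgeSet)
    (hfree : ∀ f ∈ H, f ≠ e → ∀ v ∈ e, v ∉ f) : e ∈ H := by
  classical
  by_contra heH
  obtain ⟨⟨hH, hH', hd, hsum⟩, hmu⟩ := h
  dsimp only at hH hH' hd hsum hmu
  have hI : IsMatchingSet G (insert e H) :=
    hH.insert he fun f hf => hfree f hf (ne_of_mem_of_not_mem hf heH)
  have hE : IsMatchingSet G (H'.erase e) := hH'.mono (H'.erase_subset e)
  have hdis : Disjoint (insert e H) (H'.erase e) := by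
    rw [Finset.disjoint_insert_left]
    exact ⟨Finset.notMem_erase e H', hd.mono_right (H'.erase_subset e)⟩
  have hle := card_add_card_le_lamG hI hE hdis
  have hpred := H'.pred_card_le_card_erase (a := e)
  have hcard := Finset.card_insert_of_notMem heH
  have hmax := card_le_muG (p := (insert e H, H'.erase e)) ⟨hI, hE, hdis, by dsimp only; omega⟩
  dsimp only at hmax
  omega

theorem outer_mem_edgeSet {k : ℕ} (attach : Fin (4 + k) → Fin 2) (i : Fin (4 + k)) :
    s((Sum.inr (i, 0) : SpannerV k), Sum.inr (i, 1)) ∈ (spannerGraph k attach).edgeSet := by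
  rw [SimpleGraph.mem_edgeSet, spannerGraph, SimpleGraph.fromRel_adj]
  exact ⟨by simp, Or.inl (Or.inr (Or.inr ⟨i, rfl, rfl⟩))⟩

/-- An edge meeting the outer edge of a leg is the inner or the outer edge of this leg. -/
theorem eq_inner_or_outer {k : ℕ} {attach : Fin (4 + k) → Fin 2} {i : Fin (4 + k)}
    {f : Sym2 (SpannerV k)} (hf : f ∈ (spannerGraph k attach).edgeSet) {v : SpannerV k}
    (hv : v ∈ s((Sum.inr (i, 0) : SpannerV k), Sum.inr (i, 1))) (hvf : v ∈ f) :
    f = s((Sum.inl (attach i) : SpannerV k), Sum.inr (i, 0)) ∨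
      f = s((Sum.inr (i, 0) : SpannerV k), Sum.inr (i, 1)) := by
  induction f using Sym2.ind with
  | _ x y =>
    rw [SimpleGraph.mem_edgeSet, spannerGraph, SimpleGraph.fromRel_adj] at hf
    rw [Sym2.mem_iff] at hv hvf
    obtain ⟨-, h | h⟩ := hf <;> obtain ⟨rfl, rfl⟩ | ⟨j, rfl, rfl⟩ | ⟨j, rfl, rfl⟩ := h <;>
      rcases hv with rfl | rfl <;> simp_all [Sym2.eq_swap]

/-- A matching contains at most one inner edge at each central vertex. -/
theorem card_inner_le_one {k : ℕ} {attach : Fin (4 + k) → Fin 2} {M : Finset (Sym2 (SpannerV k))}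
    (hM : IsMatchingSet (spannerGraph k attach) M) (c : Fin 2) :
    (Finset.univ.filter fun i : Fin (4 + k) =>
      attach i = c ∧ s((Sum.inl (attach i) : SpannerV k), Sum.inr (i, 0)) ∈ M).card ≤ 1 := by
  rw [Finset.card_le_one]
  intro i hi j hj
  rw [Finset.mem_filter] at hi hj
  by_contra hne
  exact hM.2 _ hi.2.2 _ hj.2.2 (by simp [hne]) (Sum.inl c) (by simp [hi.2.1]) (by simp [hj.2.1])

/-- For (H, H') ∈ Λ_μ of a k-spanner: at most two legs attached to each central
vertex have their inner edge in H ∪ H', and every leg whose inner edge is not in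
H ∪ H' has its outer edge in H. -/
theorem stmt3 (k : ℕ) (attach : Fin (4 + k) → Fin 2) (hat : IsKSpannerAttach k attach)
    (H H' : Finset (Sym2 (SpannerV k)))
    (hHH : (H, H') ∈ LambdaMuSet (spannerGraph k attach)) :
    (∀ c : Fin 2,
      (Finset.univ.filter fun i : Fin (4 + k) =>
        attach i = c ∧ s((Sum.inl (attach i) : SpannerV k), Sum.inr (i, 0)) ∈ H ∪ H').card ≤ 2) ∧
    (∀ i : Fin (4 + k),
      s((Sum.inl (attach i) : SpannerV k), Sum.inr (i, 0)) ∉ H ∪ H' →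
      s((Sum.inr (i, 0) : SpannerV k), Sum.inr (i, 1)) ∈ H) := by
  classical
  refine ⟨fun c => ?_, fun i hi => ?_⟩
  · obtain ⟨⟨hH, hH', -⟩, -⟩ := hHH
    simp only [Finset.mem_union, and_or_left, Finset.filter_or]
    exact (Finset.card_union_le _ _).trans
      (add_le_add (card_inner_le_one hH c) (card_inner_le_one hH' c))
  · refine mem_of_mem_LambdaMuSet hHH (outer_mem_edgeSet attach i) fun f hf hne v hv hvf => ?_
    rcases eq_inner_or_outer (hHH.1.1.1 hf) hv hvf with rfl | rfl
    · exact hi (Finset.mem_union_left _ hf)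
    · exact hne rfl
end

section
/- For every integer k ≥ 0 and every k-spanner S, λ(S) = k + 8 and μ(S) = k + 4. -/
open Finset

lemma IsMatchingSet.eq_of_mem {V : Type*} {G : SimpleGraph V} {M : Finset (Sym2 V)}
    (hM : IsMatchingSet G M) {e f : Sym2 V} (he : e ∈ M) (hf : f ∈ M) {v : V}
    (hve : v ∈ e) (hvf : v ∈ f) : e = f := by
  by_contra h
  exact hM.2 e he f hf h v hve hvf

namespace Spanner

variable {k : ℕ} (attach : Fin (4 + k) → Fin 2)

/-- The edge joining the two central vertices. -/
def central (k : ℕ) : Sym2 (SpannerV k) := s(Sum.inl 0, Sum.inl 1)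

/-- The edge of leg `i` incident to its central vertex. -/
def inner (i : Fin (4 + k)) : Sym2 (SpannerV k) := s(Sum.inl (attach i), Sum.inr (i, 0))

/-- The pendant edge of leg `i`. -/
def outer (i : Fin (4 + k)) : Sym2 (SpannerV k) := s(Sum.inr (i, 0), Sum.inr (i, 1))

lemma mem_edgeSet_iff (e : Sym2 (SpannerV k)) :
    e ∈ (spannerGraph k attach).edgeSet ↔
      e = central k ∨ (∃ i, e = inner attach i) ∨ ∃ i, e = outer i := by
  induction e using Sym2.ind with
  | _ u v =>
    simp only [SimpleGraph.mem_edgeSet, spannerGraph, SimpleGraph.fromRel_adj, central, inner,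
      outer, Sym2.eq_iff]
    constructor
    · rintro ⟨-, (h | ⟨i, h⟩ | ⟨i, h⟩) | (h | ⟨i, h⟩ | ⟨i, h⟩)⟩
      · exact .inl (.inl h)
      · exact .inr (.inl ⟨i, .inl h⟩)
      · exact .inr (.inr ⟨i, .inl h⟩)
      · exact .inl (.inr h.symm)
      · exact .inr (.inl ⟨i, .inr h.symm⟩)
      · exact .inr (.inr ⟨i, .inr h.symm⟩)
    · rintro ((⟨rfl, rfl⟩ | ⟨rfl, rfl⟩) | ⟨i, ⟨rfl, rfl⟩ | ⟨rfl, rfl⟩⟩ |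
        ⟨i, ⟨rfl, rfl⟩ | ⟨rfl, rfl⟩⟩) <;> simp

variable {attach}

lemma inner_ne_outer (i j : Fin (4 + k)) : inner attach i ≠ outer j := by
  simp [inner, outer]

lemma inner_injective : Function.Injective (inner attach) := by
  intro i j h
  exact (show attach i = attach j ∧ i = j by simpa [inner] using h).2

lemma outer_injective : Function.Injective (outer (k := k)) := by
  intro i j h
  simpa [outer] using h

/-- The legs whose inner edge belongs to `M`. -/
def innerLegs (attach : Fin (4 + k) → Fin 2) (M : Finset (Sym2 (SpannerV k))) :
    Finset (Fin (4 + k)) :=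
  univ.filter fun i => inner attach i ∈ M

/-- The legs whose outer edge belongs to `M`. -/
def outerLegs (M : Finset (Sym2 (SpannerV k))) : Finset (Fin (4 + k)) :=
  univ.filter fun i => outer i ∈ M

/-- The number of central edges in `M`, which is zero or one. -/
def centralCount (M : Finset (Sym2 (SpannerV k))) : ℕ := if central k ∈ M then 1 else 0

lemma card_le {M : Finset (Sym2 (SpannerV k))} (hM : IsMatchingSet (spannerGraph k attach) M) :
    M.card ≤ centralCount M + (innerLegs attach M).card + (outerLegs M).card := by
  have hsub : M ⊆ ((if central k ∈ M then {central k} else ∅) ∪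
      (innerLegs attach M).image (inner attach)) ∪ (outerLegs M).image outer := by
    intro e he
    rcases (mem_edgeSet_iff attach e).1 (hM.1 he) with rfl | ⟨i, rfl⟩ | ⟨i, rfl⟩
    · simp [he]
    · exact mem_union_left _ (mem_union_right _ (mem_image_of_mem _ (by simp [innerLegs, he])))
    · exact mem_union_right _ (mem_image_of_mem _ (by simp [outerLegs, he]))
  refine (card_le_card hsub).trans ((card_union_le _ _).trans
    (Nat.add_le_add ((card_union_le _ _).trans (Nat.add_le_add ?_ card_image_le)) card_image_le))
  unfold centralCount
  split_ifs <;> simp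

lemma card_innerLegs_add_card_outerLegs_le {M : Finset (Sym2 (SpannerV k))}
    (hM : IsMatchingSet (spannerGraph k attach) M) :
    (innerLegs attach M).card + (outerLegs M).card ≤ 4 + k := by
  rw [← card_union_of_disjoint]
  · simpa using card_le_univ (innerLegs attach M ∪ outerLegs M)
  · rw [Finset.disjoint_left]
    intro i hi ho
    simp only [innerLegs, outerLegs, mem_filter, mem_univ, true_and] at hi ho
    exact inner_ne_outer i i
      (hM.eq_of_mem hi ho (v := Sum.inr (i, 0)) (by simp [inner]) (by simp [outer]))

lemma card_outerLegs_add_le {H H' : Finset (Sym2 (SpannerV k))} (hd : Disjoint H H') :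
    (outerLegs H).card + (outerLegs H').card ≤ 4 + k := by
  rw [← card_union_of_disjoint]
  · simpa using card_le_univ (outerLegs H ∪ outerLegs H')
  · rw [Finset.disjoint_left]
    intro i hi ho
    simp only [outerLegs, mem_filter, mem_univ, true_and] at hi ho
    exact Finset.disjoint_left.1 hd hi ho

lemma card_innerLegs_add_le {M : Finset (Sym2 (SpannerV k))}
    (hM : IsMatchingSet (spannerGraph k attach) M) :
    (innerLegs attach M).card + 2 * centralCount M ≤ 2 := by
  unfold centralCount
  split_ifs with hc
  · suffices innerLegs attach M = ∅ by simp [this]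
    refine filter_eq_empty_iff.2 fun i _ hi => ?_
    have hmem : (Sum.inl (attach i) : SpannerV k) ∈ central k := by
      rcases Fin.exists_fin_two.1 ⟨attach i, rfl⟩ with h | h <;> simp [central, h]
    have := hM.eq_of_mem hi hc (v := Sum.inl (attach i)) (by simp [inner]) hmem
    simp [inner, central] at this
  · have hinj : Set.InjOn attach (innerLegs attach M) := by
      intro i hi j hj hij
      simp only [innerLegs, coe_filter, mem_univ, true_and, Set.mem_ofPred_eq] at hi hj
      exact inner_injective (hM.eq_of_mem hi hj (v := Sum.inl (attach i))
        (by simp [inner]) (by simp [inner, hij]))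
    simpa using card_le_card_of_injOn attach (fun _ _ => mem_univ _) hinj

lemma card_add_card_le {H H' : Finset (Sym2 (SpannerV k))}
    (hH : IsMatchingSet (spannerGraph k attach) H)
    (hH' : IsMatchingSet (spannerGraph k attach) H') (hd : Disjoint H H') :
    H.card + H'.card + centralCount H ≤ k + 8 := by
  have h1 := card_le hH
  have h2 := card_le hH'
  have h3 := card_outerLegs_add_le hd
  have h4 := card_innerLegs_add_le hH
  have h5 := card_innerLegs_add_le hH'
  omega

lemma card_le_of_card_add_card_eq {H H' : Finset (Sym2 (SpannerV k))}
    (hH : IsMatchingSet (spannerGraph k attach) H)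
    (hH' : IsMatchingSet (spannerGraph k attach) H') (hd : Disjoint H H')
    (h : H.card + H'.card = k + 8) : H.card ≤ k + 4 := by
  have h1 := card_add_card_le hH hH' hd
  have h2 := card_le hH
  have h3 := card_innerLegs_add_card_outerLegs_le hH
  omega

variable (attach)

/-- The edge of leg `i` that is inner if `i ∈ T` and outer otherwise. -/
def legEdge (T : Finset (Fin (4 + k))) (i : Fin (4 + k)) : Sym2 (SpannerV k) :=
  if i ∈ T then inner attach i else outer i

variable {attach}

lemma legEdge_eq_iff {T T' : Finset (Fin (4 + k))} {i j : Fin (4 + k)} :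
    legEdge attach T i = legEdge attach T' j ↔ i = j ∧ (i ∈ T ↔ j ∈ T') := by
  unfold legEdge
  split_ifs with h h' h'
  · simp [inner_injective.eq_iff, h, h']
  · simp [inner_ne_outer, h, h']
  · simp [(inner_ne_outer _ _).symm, h, h']
  · simp [outer_injective.eq_iff, h, h']

lemma legEdge_injective (T : Finset (Fin (4 + k))) : Function.Injective (legEdge attach T) :=
  fun _ _ h => (legEdge_eq_iff.1 h).1

lemma isMatchingSet_image_legEdge {S T : Finset (Fin (4 + k))} (hT : Set.InjOn attach T) :
    IsMatchingSet (spannerGraph k attach) (S.image (legEdge attach T)) := by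
  constructor
  · intro e he
    obtain ⟨i, -, rfl⟩ := mem_image.1 (mem_coe.1 he)
    rw [mem_edgeSet_iff, legEdge]
    split_ifs
    · exact .inr (.inl ⟨i, rfl⟩)
    · exact .inr (.inr ⟨i, rfl⟩)
  · intro e he f hf hne v hve hvf
    obtain ⟨i, -, rfl⟩ := mem_image.1 he
    obtain ⟨j, -, rfl⟩ := mem_image.1 hf
    have hij : i ≠ j := fun h => hne (h ▸ rfl)
    have hinj : i ∈ T → j ∈ T → attach i ≠ attach j := fun hi hj h => hij (hT hi hj h)
    unfold legEdge at hve hvf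
    split_ifs at hve hvf <;> simp only [inner, outer, Sym2.mem_iff] at hve hvf <;>
      rcases hve with rfl | rfl <;> rcases hvf with h | h <;> simp_all

lemma exists_matchings (hat : IsKSpannerAttach k attach) :
    ∃ H H' : Finset (Sym2 (SpannerV k)), IsMatchingSet (spannerGraph k attach) H ∧
      IsMatchingSet (spannerGraph k attach) H' ∧ Disjoint H H' ∧
      H.card = k + 4 ∧ H'.card = 4 := by
  obtain ⟨i₁, hi₁, i₂, hi₂, hi⟩ := one_lt_card.1 hat.1
  obtain ⟨j₁, hj₁, j₂, hj₂, hj⟩ := one_lt_card.1 hat.2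
  simp only [mem_filter, mem_univ, true_and] at hi₁ hi₂ hj₁ hj₂
  have hne {i j : Fin (4 + k)} (h0 : attach i = 0) (h1 : attach j = 1) : i ≠ j := by
    rintro rfl
    simp [h0] at h1
  have hinj {i j : Fin (4 + k)} (h0 : attach i = 0) (h1 : attach j = 1) :
      Set.InjOn attach ({i, j} : Finset (Fin (4 + k))) := by
    simp [Set.InjOn, h0, h1]
  refine ⟨univ.image (legEdge attach {i₁, j₁}),
    ({i₁, i₂, j₁, j₂} : Finset _).image (legEdge attach {i₂, j₂}),
    isMatchingSet_image_legEdge (hinj hi₁ hj₁), isMatchingSet_image_legEdge (hinj hi₂ hj₂),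
    ?_, ?_, ?_⟩
  · rw [Finset.disjoint_left]
    intro e he he'
    obtain ⟨i, -, rfl⟩ := mem_image.1 he
    obtain ⟨j, hjm, hij⟩ := mem_image.1 he'
    obtain ⟨rfl, h⟩ := legEdge_eq_iff.1 hij
    have h11 := hne hi₁ hj₁
    have h12 := hne hi₁ hj₂
    have h21 := hne hi₂ hj₁
    have h22 := hne hi₂ hj₂
    simp only [mem_insert, mem_singleton] at hjm h
    grind
  · rw [card_image_of_injective _ (legEdge_injective _), card_univ, Fintype.card_fin, add_comm]
  · rw [card_image_of_injective _ (legEdge_injective _)]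
    simp [hi, hj, hne hi₁ hj₁, hne hi₁ hj₂, hne hi₂ hj₁, hne hi₂ hj₂]

end Spanner

/-- For every k-spanner S, λ(S) = k + 8 and μ(S) = k + 4. -/
theorem stmt4 (k : ℕ) (attach : Fin (4 + k) → Fin 2) (hat : IsKSpannerAttach k attach) :
    lamG (spannerGraph k attach) = k + 8 ∧ muG (spannerGraph k attach) = k + 4 := by
  obtain ⟨H, H', hH, hH', hd, hc, hc'⟩ := Spanner.exists_matchings hat
  have hlam : lamG (spannerGraph k attach) = k + 8 := by
    refine IsGreatest.csSup_eq ⟨⟨H, H', hH, hH', hd, by omega⟩, ?_⟩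
    rintro n ⟨M, M', hM, hM', hMd, rfl⟩
    exact (Nat.le_add_right _ _).trans (Spanner.card_add_card_le hM hM' hMd)
  refine ⟨hlam, IsGreatest.csSup_eq ⟨⟨(H, H'), ⟨hH, hH', hd, by simp only; omega⟩, hc⟩, ?_⟩⟩
  rintro n ⟨⟨M, M'⟩, ⟨hM, hM', hMd, hcard⟩, rfl⟩
  exact Spanner.card_le_of_card_add_card_eq hM hM' hMd (hcard.trans hlam)
end
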